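/- arXiv:2409.03442 — 3 statements merged into one kernel-verified Lean document; each statement's English description precedes it below -/
import Mathlib

section
/- Let k be a field of characteristic p > 0 and K = k(x,y). Let f, g ∈ K, not both zero, with ∂_x(f) + ∂_y(g) = 0, and set c_f = −∂_y^{p−1}(f) and c_g = −∂_x^{p−1}(g). Then the derivation ∂ = f·∂_x + g·∂_y is p-closed if and only if f^p·c_g = g^p·c_f. -/
open MvPolynomial

noncomputable section

/-- The rational function field `k(x,y)`, realized as the fraction field of `k[x,y]`. -/
abbrev RatFld2 (k : Type) [Field k] : Type := FractionRing (MvPolynomial (Fin 2) k)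

/-- The image of the indeterminate `x` in `k(x,y)`. -/
abbrev xK (k : Type) [Field k] : RatFld2 k :=
  algebraMap (MvPolynomial (Fin 2) k) (RatFld2 k) (X 0)

/-- The image of the indeterminate `y` in `k(x,y)`. -/
abbrev yK (k : Type) [Field k] : RatFld2 k :=
  algebraMap (MvPolynomial (Fin 2) k) (RatFld2 k) (X 1)

namespace Derivation

section CommRing

variable {R A : Type*} [CommRing R] [CommRing A] [Algebra R A]

theorem iterate_apply_mul_of_apply_eq_zero (D : Derivation R A A) {c : A} (hc : D c = 0) (n : ℕ)
    (z : A) : (⇑D)^[n] (c * z) = c * (⇑D)^[n] z := by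
  induction n with
  | zero => rfl
  | succ n ih => simp [Function.iterate_succ_apply', ih, hc]

theorem iterate_apply_sub (D : Derivation R A A) (n : ℕ) (a b : A) :
    (⇑D)^[n] (a - b) = (⇑D)^[n] a - (⇑D)^[n] b := by
  induction n with
  | zero => rfl
  | succ n ih => simp [Function.iterate_succ_apply', ih]

theorem iterate_apply_zero (D : Derivation R A A) (n : ℕ) : (⇑D)^[n] 0 = 0 :=
  Function.iterate_fixed (map_zero D) n

/-- The general Leibniz rule. -/
theorem iterate_apply_mul (D : Derivation R A A) (n : ℕ) (a b : A) :
    (⇑D)^[n] (a * b) = ∑ ij ∈ Finset.HasAntidiagonal.antidiagonal n,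
      (n.choose ij.1 : A) * ((⇑D)^[ij.1] a * (⇑D)^[ij.2] b) := by
  induction n with
  | zero => simp
  | succ n ih =>
    rw [Finset.sum_antidiagonal_choose_succ_mul (fun i j => (⇑D)^[i] a * (⇑D)^[j] b) n]
    simp only [Function.iterate_succ_apply', ih, map_sum, ← Finset.sum_add_distrib]
    refine Finset.sum_congr rfl fun ⟨i, j⟩ hij => ?_
    rw [n.choose_symm_of_eq_add (Finset.HasAntidiagonal.mem_antidiagonal.1 hij).symm]
    simp only [leibniz, map_natCast, smul_eq_mul]
    ring

end CommRing

/-- In a ring of prime characteristic `p`, binomial sums along `p` reduce to their end terms. -/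
theorem _root_.CharP.sum_antidiagonal_choose_mul {A : Type*} [CommRing A] (p : ℕ) (hp : p.Prime)
    [CharP A p] (F : ℕ → ℕ → A) :
    ∑ ij ∈ Finset.HasAntidiagonal.antidiagonal p, (p.choose ij.1 : A) * F ij.1 ij.2 =
      F 0 p + F p 0 := by
  rw [Finset.Nat.sum_antidiagonal_eq_sum_range_succ (fun i j => (p.choose i : A) * F i j),
    Finset.sum_range_succ, ← Finset.sum_erase_add _ _ (Finset.mem_range.2 hp.pos),
    Finset.sum_eq_zero]
  · simp
  · intro i hi
    simp only [Finset.mem_erase, Finset.mem_range] at hi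
    rw [(CharP.cast_eq_zero_iff A p _).2 (hp.dvd_choose_self hi.1 hi.2), zero_mul]

/-- The `p`-th iterate of a derivation in characteristic `p`, as a derivation. -/
def iterateChar {R A : Type*} [CommRing R] [CommRing A] [Algebra R A] (p : ℕ) (hp : p.Prime)
    [CharP A p] (D : Derivation R A A) : Derivation R A A :=
  Derivation.mk' ((D : A →ₗ[R] A) ^ p) fun a b => by
    simp only [Module.End.pow_apply, coeFn_coe, smul_eq_mul]
    rw [D.iterate_apply_mul,
      CharP.sum_antidiagonal_choose_mul p hp fun i j => (⇑D)^[i] a * (⇑D)^[j] b]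
    simp [mul_comm]

theorem iterateChar_apply {R A : Type*} [CommRing R] [CommRing A] [Algebra R A] (p : ℕ)
    (hp : p.Prime) [CharP A p] (D : Derivation R A A) (z : A) :
    D.iterateChar p hp z = (⇑D)^[p] z := by
  simp [iterateChar, Module.End.pow_apply]

section Field

variable {k K : Type*} [Field k] [Field K] [Algebra k K]

/-- The polynomials `(D + t a)ⁿ 1` in an auxiliary variable `t`. -/
def twistedPoly [Differential K] (a : K) (n : ℕ) : Polynomial K :=
  (fun q => Differential.mapCoeffs q + Polynomial.X * Polynomial.C a * q)^[n] 1

theorem twistedPoly_succ [Differential K] (a : K) (n : ℕ) :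
    twistedPoly a (n + 1) = Differential.mapCoeffs (twistedPoly a n) +
      Polynomial.X * Polynomial.C a * twistedPoly a n :=
  Function.iterate_succ_apply' _ _ _

theorem coeff_twistedPoly_succ_zero [Differential K] (a : K) (n : ℕ) :
    (twistedPoly a (n + 1)).coeff 0 = 0 := by
  induction n with
  | zero => simp [twistedPoly, mul_assoc]
  | succ n ih => rw [twistedPoly_succ]; simp [mul_assoc, ih]

theorem coeff_twistedPoly_of_lt [Differential K] (a : K) (n m : ℕ) (h : n < m) :
    (twistedPoly a n).coeff m = 0 := by
  induction n generalizing m with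
  | zero => simp [twistedPoly, Polynomial.coeff_one, h.ne']
  | succ n ih =>
    obtain ⟨m, rfl⟩ := Nat.exists_eq_succ_of_ne_zero (by lia : m ≠ 0)
    rw [twistedPoly_succ]
    simp [mul_assoc, Polynomial.coeff_X_mul, ih m (by lia), ih (m + 1) (by lia)]

theorem coeff_twistedPoly_self [Differential K] (a : K) (n : ℕ) :
    (twistedPoly a n).coeff n = a ^ n := by
  induction n with
  | zero => simp [twistedPoly]
  | succ n ih =>
    rw [twistedPoly_succ]
    simp [mul_assoc, Polynomial.coeff_X_mul, ih, coeff_twistedPoly_of_lt a n (n + 1), pow_succ']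

theorem derivative_mapCoeffs [Differential K] (q : Polynomial K) :
    Polynomial.derivative (Differential.mapCoeffs q) =
      Differential.mapCoeffs (Polynomial.derivative q) := by
  ext m
  have h : Differential.deriv ((m : K) + 1) = 0 := by simp
  simp [Polynomial.coeff_derivative, h, mul_comm]

theorem derivative_twistedPoly [Differential K] (a : K) (n : ℕ) :
    Polynomial.derivative (twistedPoly a n) = ∑ ij ∈ Finset.HasAntidiagonal.antidiagonal n,
      (n.choose ij.1 : Polynomial K) * (Polynomial.C (if ij.1 = 0 then 0 else
        (⇑(Differential.deriv (R := K)))^[ij.1 - 1] a) * twistedPoly a ij.2) := by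
  induction n with
  | zero => simp [twistedPoly]
  | succ n ih =>
    rw [Finset.sum_antidiagonal_choose_succ_mul (fun i j => Polynomial.C (if i = 0 then 0 else
        (⇑(Differential.deriv (R := K)))^[i - 1] a) * twistedPoly a j) n, twistedPoly_succ]
    have key : Polynomial.C a * twistedPoly a n = ∑ ij ∈ Finset.HasAntidiagonal.antidiagonal n,
        (n.choose ij.1 : Polynomial K) *
          (Polynomial.C (if ij.1 = 0 then a else 0) * twistedPoly a ij.2) := by
      rw [Finset.sum_eq_single (0, n)]
      · simp
      · rintro ⟨i, j⟩ hij hne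
        have : i ≠ 0 := by
          rintro rfl
          simp_all
        simp [this]
      · simp
    rw [Polynomial.derivative_add, derivative_mapCoeffs, Polynomial.derivative_mul,
      Polynomial.derivative_mul, ih]
    simp only [Polynomial.derivative_X, Polynomial.derivative_C, mul_zero, add_zero, one_mul]
    rw [key, map_sum, Finset.mul_sum, ← Finset.sum_add_distrib, ← Finset.sum_add_distrib,
      ← Finset.sum_add_distrib]
    refine Finset.sum_congr rfl fun ⟨i, j⟩ hij => ?_
    rw [← n.choose_symm_of_eq_add (Finset.HasAntidiagonal.mem_antidiagonal.1 hij).symm]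
    rcases i with _ | i
    · simp [twistedPoly_succ]
    · simp [twistedPoly_succ, Function.iterate_succ_apply']
      ring

theorem eval_one_twistedPoly [Differential K] {y : K} (hy : y ≠ 0) (n : ℕ) :
    (twistedPoly (Differential.deriv y / y) n).eval 1 =
      (⇑(Differential.deriv (R := K)))^[n] y / y := by
  have heval (q : Polynomial K) :
      (Differential.mapCoeffs q).eval 1 = Differential.deriv (q.eval 1) := by
    simp [Polynomial.eval_eq_sum_range' (n := max q.natDegree
      (Differential.mapCoeffs q).natDegree + 1) (p := q) (by lia),
      Polynomial.eval_eq_sum_range' (n := max q.natDegree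
      (Differential.mapCoeffs q).natDegree + 1) (p := Differential.mapCoeffs q) (by lia)]
  induction n with
  | zero => simp [twistedPoly, hy]
  | succ n ih =>
    rw [twistedPoly_succ, Polynomial.eval_add, heval, Polynomial.eval_mul, ih,
      Function.iterate_succ_apply', leibniz_div]
    simp only [Polynomial.eval_mul, Polynomial.eval_X, Polynomial.eval_C, smul_eq_mul]
    field_simp
    ring

theorem twistedPoly_prime [Differential K] (p : ℕ) (hp : p.Prime) [CharP K p] (a : K) :
    twistedPoly a p =
      Polynomial.X * Polynomial.C ((⇑(Differential.deriv (R := K)))^[p - 1] a) +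
        Polynomial.X ^ p * Polynomial.C (a ^ p) := by
  have hder : Polynomial.derivative (twistedPoly a p) =
      Polynomial.C ((⇑(Differential.deriv (R := K)))^[p - 1] a) := by
    rw [derivative_twistedPoly, CharP.sum_antidiagonal_choose_mul p hp (fun i j =>
      Polynomial.C (if i = 0 then 0 else
        (⇑(Differential.deriv (R := K)))^[i - 1] a) * twistedPoly a j)]
    simp [hp.ne_zero, twistedPoly]
  have h2 := hp.two_le
  ext m
  rcases m with _ | m
  · obtain ⟨q, rfl⟩ := Nat.exists_eq_succ_of_ne_zero hp.ne_zero
    simp [coeff_twistedPoly_succ_zero]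
  · rcases lt_trichotomy (m + 1) p with h | h | h
    · have hm : ((m + 1 : ℕ) : K) ≠ 0 := fun h0 =>
        absurd (Nat.le_of_dvd (by lia) ((CharP.cast_eq_zero_iff K p _).1 h0)) (by lia)
      have := congrArg (fun q => Polynomial.coeff q m) hder
      simp only [Polynomial.coeff_derivative] at this
      push_cast at hm
      apply mul_right_cancel₀ hm
      rw [this]
      rcases m with _ | m
      · simp [-map_pow, Polynomial.coeff_X_pow, show 1 ≠ p by lia]
      · simp [-map_pow, Polynomial.coeff_X_pow, show m + 1 + 1 ≠ p by lia]
    · rw [h, coeff_twistedPoly_self, ← h]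
      simp [-map_pow, Polynomial.coeff_X_pow, Polynomial.coeff_C, show m ≠ 0 by lia]
    · rw [coeff_twistedPoly_of_lt a p _ h]
      simp [-map_pow, Polynomial.coeff_X_pow, Polynomial.coeff_C, show m ≠ 0 by lia,
        show m + 1 ≠ p by lia]

/-- The Frobenius power of `y` is a constant of every derivation. -/
theorem apply_pow_char (p : ℕ) [CharP K p] (D : Derivation k K K) (y : K) : D (y ^ p) = 0 := by
  rw [leibniz_pow]
  simp

/-- Hochschild's formula: `D^{p-1}(y^{p-1} D y) = y^{p-1} D^p y - (D y)^p`. -/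
theorem iterate_pred_pow_mul_apply (p : ℕ) (hp : p.Prime) [CharP K p] (D : Derivation k K K)
    (y : K) :
    (⇑D)^[p - 1] (y ^ (p - 1) * D y) = y ^ (p - 1) * (⇑D)^[p] y - D y ^ p := by
  have h2 := hp.two_le
  rcases eq_or_ne y 0 with rfl | hy
  · have : p - 1 ≠ 0 := by lia
    simp [this, hp.ne_zero]
  · let _ : Differential K := ⟨D.restrictScalars ℤ⟩
    have h := eval_one_twistedPoly hy p
    rw [twistedPoly_prime p hp] at h
    change Polynomial.eval 1 (Polynomial.X * Polynomial.C ((⇑D)^[p - 1] (D y / y)) +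
      Polynomial.X ^ p * Polynomial.C ((D y / y) ^ p)) = (⇑D)^[p] y / y at h
    simp only [Polynomial.eval_add, Polynomial.eval_mul, Polynomial.eval_X, Polynomial.eval_C,
      Polynomial.eval_pow, one_pow, one_mul] at h
    have hyp : y ^ p = y ^ (p - 1) * y := by rw [← pow_succ, Nat.sub_add_cancel hp.one_le]
    have e : y ^ (p - 1) * D y = y ^ p * (D y / y) := by rw [hyp]; field_simp
    rw [e, iterate_apply_mul_of_apply_eq_zero D (apply_pow_char p D y), eq_sub_of_add_eq h,
      mul_sub, div_pow, mul_div_cancel₀ _ (pow_ne_zero p hy), hyp]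
    field_simp

/-- A truncated antiderivative along a derivation admitting a coordinate `x`. -/
theorem exists_apply_eq_add_pow_mul (p : ℕ) (hp : p.Prime) [CharP K p] (D : Derivation k K K)
    {x : K} (hx : D x = 1) (f : K) :
    ∃ u, D u = f + x ^ (p - 1) * (⇑D)^[p - 1] f ∧
      ∀ E : Derivation k K K, E x = 0 → (∀ z, E (D z) = D (E z)) → E f = 0 → E u = 0 := by
  have hfac : ∀ n < p, (n.factorial : K) ≠ 0 := fun n hn h0 =>
    absurd ((hp.dvd_factorial).1 ((CharP.cast_eq_zero_iff K p _).1 h0)) (by lia)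
  have main : ∀ n < p, ∃ u, D u = f - (-1) ^ n * x ^ n / (n.factorial : K) * (⇑D)^[n] f ∧
      ∀ E : Derivation k K K, E x = 0 → (∀ z, E (D z) = D (E z)) → E f = 0 → E u = 0 := by
    intro n
    induction n with
    | zero => exact fun _ => ⟨0, by simp, by simp⟩
    | succ n ih =>
      intro hn
      obtain ⟨u, hu, hE⟩ := ih (by lia)
      refine ⟨u + (-1) ^ n * (x ^ (n + 1) / ((n + 1).factorial : K)) * (⇑D)^[n] f, ?_, ?_⟩
      · have h1 := hfac (n + 1) hn
        have h0 := hfac n (by lia)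
        have hs : D ((-1) ^ n : K) = 0 := by simp [leibniz_pow]
        rw [map_add, hu, leibniz, leibniz, hs, leibniz_div_const _ _ _ (map_natCast D _),
          leibniz_pow, hx, Function.iterate_succ_apply']
        rw [Nat.factorial_succ] at h1 ⊢
        push_cast at h1 ⊢
        have h2 : (n : K) + 1 ≠ 0 := left_ne_zero_of_mul h1
        simp only [smul_eq_mul, nsmul_eq_mul]
        push_cast
        field_simp
        ring
      · intro E hEx hcomm hEf
        have hs : E ((-1) ^ n : K) = 0 := by simp [leibniz_pow]
        have hit : E ((⇑D)^[n] f) = 0 := by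
          rw [show E ((⇑D)^[n] f) = (⇑D)^[n] (E f) from
            (Function.Commute.iterate_right (f := ⇑E) (g := ⇑D) hcomm n) f, hEf,
            iterate_apply_zero]
        rw [map_add, hE E hEx hcomm hEf, leibniz, leibniz, hs, hit,
          leibniz_div_const _ _ _ (map_natCast E _), leibniz_pow, hEx]
        simp
  obtain ⟨u, hu, hE⟩ := main (p - 1) (Nat.sub_lt hp.pos one_pos)
  refine ⟨u, ?_, hE⟩
  have : Fact p.Prime := ⟨hp⟩
  have hw : ((p - 1).factorial : K) = -1 := by
    rw [← _root_.map_natCast (ZMod.castHom (dvd_refl p) K), ZMod.wilsons_lemma,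
      _root_.map_neg, _root_.map_one]
  have hs : ((-1) ^ (p - 1) : K) = 1 := by
    simpa using congrArg (ZMod.castHom (dvd_refl p) K)
      (ZMod.pow_card_sub_one_eq_one (neg_ne_zero.2 one_ne_zero : (-1 : ZMod p) ≠ 0))
  rw [hu, hw, hs]
  ring

end Field

theorem ratFld2_ext {k : Type} [Field k] {D E : Derivation k (RatFld2 k) (RatFld2 k)}
    (hx : D (xK k) = E (xK k)) (hy : D (yK k) = E (yK k)) : D = E := by
  have hpoly : D.compAlgebraMap (MvPolynomial (Fin 2) k) =
      E.compAlgebraMap (MvPolynomial (Fin 2) k) := by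
    refine MvPolynomial.derivation_ext fun i => ?_
    fin_cases i
    · exact hx
    · exact hy
  have h (q : MvPolynomial (Fin 2) k) : D (algebraMap _ _ q) = E (algebraMap _ _ q) :=
    congr_fun hpoly q
  ext z
  obtain ⟨a, b, -, rfl⟩ := IsFractionRing.div_surjective (A := MvPolynomial (Fin 2) k) z
  rw [leibniz_div, leibniz_div, h, h]

theorem ratFld2_apply {k : Type} [Field k] {Dx Dy : Derivation k (RatFld2 k) (RatFld2 k)}
    (hDxx : Dx (xK k) = 1) (hDxy : Dx (yK k) = 0)
    (hDyx : Dy (xK k) = 0) (hDyy : Dy (yK k) = 1)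
    (E : Derivation k (RatFld2 k) (RatFld2 k)) (z : RatFld2 k) :
    E z = E (xK k) * Dx z + E (yK k) * Dy z := by
  have : E = E (xK k) • Dx + E (yK k) • Dy :=
    ratFld2_ext (by simp [hDxx, hDyx]) (by simp [hDxy, hDyy])
  conv_lhs => rw [this]
  simp

/-- Katz's formula for the closed form `f dy - g dx` and the derivation `f ∂_x + g ∂_y`. -/
theorem mul_iterate_sub_mul_iterate (p : ℕ) (hp : p.Prime) (k : Type) [Field k]
    [CharP (RatFld2 k) p] (Dx Dy : Derivation k (RatFld2 k) (RatFld2 k))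
    (hDxx : Dx (xK k) = 1) (hDxy : Dx (yK k) = 0)
    (hDyx : Dy (xK k) = 0) (hDyy : Dy (yK k) = 1)
    (f g : RatFld2 k) (hdiv : Dx f + Dy g = 0) :
    f * (⇑(f • Dx + g • Dy))^[p] (yK k) - g * (⇑(f • Dx + g • Dy))^[p] (xK k) =
      f ^ p * (⇑Dx)^[p - 1] g - g ^ p * (⇑Dy)^[p - 1] f := by
  have hp1 : p - 1 + 1 = p := Nat.sub_add_cancel hp.one_le
  have hcomm (z : RatFld2 k) : Dx (Dy z) = Dy (Dx z) := by
    have : ⁅Dx, Dy⁆ = 0 := ratFld2_ext (by simp [commutator_apply, hDxx, hDyx])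
      (by simp [commutator_apply, hDxy, hDyy])
    have := congr_fun this z
    rwa [commutator_apply, zero_apply, sub_eq_zero] at this
  have hiter (E : Derivation k (RatFld2 k) (RatFld2 k)) (h1 : E (E (xK k)) = 0)
      (h2 : E (E (yK k)) = 0) (z : RatFld2 k) : (⇑E)^[p] z = 0 := by
    have hz (w : RatFld2 k) (hw : E (E w) = 0) : (⇑E)^[p] w = 0 := by
      obtain ⟨m, rfl⟩ := Nat.exists_eq_add_of_le' hp.two_le
      rw [Function.iterate_add_apply]
      simp [hw]
    have : E.iterateChar p hp = 0 := ratFld2_ext (by rw [iterateChar_apply, hz _ h1, zero_apply])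
      (by rw [iterateChar_apply, hz _ h2, zero_apply])
    rw [← iterateChar_apply p hp, this, zero_apply]
  have hDxp := hiter Dx (by simp [hDxx]) (by simp [hDxy])
  have hDyp := hiter Dy (by simp [hDyx]) (by simp [hDyy])
  have hxc (n : ℕ) (z : RatFld2 k) : Dx ((⇑Dy)^[n] z) = (⇑Dy)^[n] (Dx z) :=
    (Function.Commute.iterate_right (f := ⇑Dx) (g := ⇑Dy) hcomm n) z
  have hyc (n : ℕ) (z : RatFld2 k) : Dy ((⇑Dx)^[n] z) = (⇑Dx)^[n] (Dy z) :=
    (Function.Commute.iterate_right (f := ⇑Dy) (g := ⇑Dx) (fun z => (hcomm z).symm) n) z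
  have hDxf : Dx f = Dy (-g) := by rw [map_neg]; exact eq_neg_of_add_eq_zero_left hdiv
  have hDyg : Dy g = Dx (-f) := by rw [map_neg]; exact eq_neg_of_add_eq_zero_right hdiv
  set c := (⇑Dy)^[p - 1] f with hc
  set d := (⇑Dx)^[p - 1] g with hd
  have hcx : Dx c = 0 := by
    rw [hc, hxc, hDxf, ← Function.iterate_succ_apply, Nat.succ_eq_add_one, hp1, hDyp]
  have hcy : Dy c = 0 := by
    rw [hc, ← Function.iterate_succ_apply' (⇑Dy), Nat.succ_eq_add_one, hp1, hDyp]
  have hdx : Dx d = 0 := by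
    rw [hd, ← Function.iterate_succ_apply' (⇑Dx), Nat.succ_eq_add_one, hp1, hDxp]
  have hdy : Dy d = 0 := by
    rw [hd, hyc, hDyg, ← Function.iterate_succ_apply, Nat.succ_eq_add_one, hp1, hDxp]
  obtain ⟨v, hv, -⟩ := exists_apply_eq_add_pow_mul p hp Dy hDyy f
  obtain ⟨w, hw, hw'⟩ := exists_apply_eq_add_pow_mul p hp Dx hDxx (g + Dx v)
  have hwy : Dy w = 0 := by
    refine hw' Dy hDyx (fun z => (hcomm z).symm) ?_
    rw [map_add, ← hcomm, hv, map_add, leibniz, ← hc, hcx, leibniz_pow, hDxy]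
    simpa [add_comm] using hdiv
  have hgv : (⇑Dx)^[p - 1] (g + Dx v) = d := by
    rw [← sub_neg_eq_add, ← map_neg, iterate_apply_sub, ← Function.iterate_succ_apply,
      Nat.succ_eq_add_one, hp1, hDxp, sub_zero]
  rw [hgv] at hw
  set D := f • Dx + g • Dy with hD
  have hDapp (z : RatFld2 k) : D z = f * Dx z + g * Dy z := by simp [hD]
  have hux : Dx (v - w) = -g - xK k ^ (p - 1) * d := by rw [map_sub, hw]; ring
  have huy : Dy (v - w) = f + yK k ^ (p - 1) * c := by rw [map_sub, hv, hwy, sub_zero]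
  have hDx : D (xK k) = f := by simp [hDapp, hDxx, hDyx]
  have hDy : D (yK k) = g := by simp [hDapp, hDxy, hDyy]
  have hDc : D c = 0 := by simp [hDapp, hcx, hcy]
  have hDd : D d = 0 := by simp [hDapp, hdx, hdy]
  have hDu : D (v - w) = c * (yK k ^ (p - 1) * D (yK k)) - d * (xK k ^ (p - 1) * D (xK k)) := by
    rw [hDapp, hux, huy, hDx, hDy]
    ring
  have h1 : (⇑D)^[p] (v - w) = c * (yK k ^ (p - 1) * (⇑D)^[p] (yK k) - g ^ p) -
      d * (xK k ^ (p - 1) * (⇑D)^[p] (xK k) - f ^ p) := by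
    conv_lhs => rw [← hp1, Function.iterate_succ_apply, hDu, iterate_apply_sub,
      iterate_apply_mul_of_apply_eq_zero D hDc, iterate_apply_mul_of_apply_eq_zero D hDd,
      iterate_pred_pow_mul_apply p hp, iterate_pred_pow_mul_apply p hp]
    rw [hDx, hDy]
  have h2 := ratFld2_apply hDxx hDxy hDyx hDyy (D.iterateChar p hp) (v - w)
  simp only [iterateChar_apply] at h2
  rw [h1, hux, huy] at h2
  linear_combination -h2

end Derivation

/-- For `K = k(x,y)` (`char k = p > 0`), `f, g ∈ K` not both zero with
`∂_x(f) + ∂_y(g) = 0`, set `c_f = −∂_y^{p−1}(f)` and `c_g = −∂_x^{p−1}(g)`.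
Then `∂ = f·∂_x + g·∂_y` is `p`-closed iff `f^p·c_g = g^p·c_f`. -/
theorem p_closed_iff_cf_cg_identity
    (p : ℕ) (hp : p.Prime) (k : Type) [Field k] [CharP k p]
    (Dx Dy : Derivation k (RatFld2 k) (RatFld2 k))
    (hDxx : Dx (xK k) = 1) (hDxy : Dx (yK k) = 0)
    (hDyx : Dy (xK k) = 0) (hDyy : Dy (yK k) = 1)
    (f g : RatFld2 k) (hfg : ¬(f = 0 ∧ g = 0))
    (hdiv : Dx f + Dy g = 0)
    (cf cg : RatFld2 k)
    (hcf : cf = -(⇑Dy)^[p - 1] f) (hcg : cg = -(⇑Dx)^[p - 1] g) :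
    (∃ a : RatFld2 k, ∀ z, (⇑(f • Dx + g • Dy))^[p] z = a * (f • Dx + g • Dy) z)
      ↔ f ^ p * cg = g ^ p * cf := by
  have : CharP (RatFld2 k) p :=
    charP_of_injective_algebraMap (algebraMap k (RatFld2 k)).injective p
  have key := Derivation.mul_iterate_sub_mul_iterate p hp k Dx Dy hDxx hDxy hDyx hDyy f g hdiv
  set D := f • Dx + g • Dy with hD
  have hDx : D (xK k) = f := by simp [hD, hDxx, hDyx]
  have hDy : D (yK k) = g := by simp [hD, hDxy, hDyy]
  have hiff : f ^ p * cg = g ^ p * cf ↔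
      f * (⇑D)^[p] (yK k) = g * (⇑D)^[p] (xK k) := by
    rw [← sub_eq_zero (a := f * _), key, hcf, hcg, sub_eq_zero, mul_neg, mul_neg, neg_inj]
  rw [hiff]
  constructor
  · rintro ⟨a, ha⟩
    rw [ha, ha, hDx, hDy]
    ring
  · intro h
    suffices ∃ a, (⇑D)^[p] (xK k) = a * f ∧ (⇑D)^[p] (yK k) = a * g by
      obtain ⟨a, hax, hay⟩ := this
      refine ⟨a, fun z => ?_⟩
      have := Derivation.ratFld2_apply hDxx hDxy hDyx hDyy (D.iterateChar p hp) z
      simp only [Derivation.iterateChar_apply] at this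
      rw [this, hax, hay, hD]
      simp only [Derivation.add_apply, Derivation.smul_apply, smul_eq_mul]
      ring
    by_cases hf : f = 0
    · have hg : g ≠ 0 := fun hg => hfg ⟨hf, hg⟩
      refine ⟨(⇑D)^[p] (yK k) / g, ?_, by field_simp⟩
      field_simp
      linear_combination -h
    · refine ⟨(⇑D)^[p] (xK k) / f, by field_simp, ?_⟩
      field_simp
      linear_combination h
end
end

section
/- Let k be a field of characteristic p > 0, R = k[x,y], and K = k(x,y). Suppose f, g ∈ R are nonzero and coprime polynomials with ∂_x(f) + ∂_y(g) = 0. Then the derivation ∂ = f·∂_x + g·∂_y of K is p-closed if and only if ∂_y^{p−1}(f) = 0 and ∂_x^{p−1}(g) = 0. -/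
open MvPolynomial

noncomputable section

/-- The partial derivative `∂_x` on `R = k[x,y]`, as a `k`-derivation. -/
abbrev Px (k : Type) [Field k] :
    Derivation k (MvPolynomial (Fin 2) k) (MvPolynomial (Fin 2) k) := pderiv 0

/-- The partial derivative `∂_y` on `R = k[x,y]`, as a `k`-derivation. -/
abbrev Py (k : Type) [Field k] :
    Derivation k (MvPolynomial (Fin 2) k) (MvPolynomial (Fin 2) k) := pderiv 1

open Finset

/-- The Leibniz rule for iterates of a derivation. -/
theorem Derivation.iterate_mul {k S : Type*} [CommRing k] [CommRing S] [Algebra k S]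
    (D : Derivation k S S) (n : ℕ) (a b : S) :
    D^[n] (a * b) =
      ∑ ij ∈ antidiagonal n, (n.choose ij.1 : S) * (D^[ij.1] a * D^[ij.2] b) := by
  induction n with
  | zero => simp
  | succ n ih =>
    rw [sum_antidiagonal_choose_succ_mul (fun i j => D^[i] a * D^[j] b),
      Function.iterate_succ_apply', ih, map_sum, ← sum_add_distrib]
    refine sum_congr rfl fun ij hij => ?_
    have h := mem_antidiagonal.mp hij
    rw [Nat.choose_symm_of_eq_add (by omega : n = ij.2 + ij.1)]
    simp only [Derivation.leibniz, Derivation.map_natCast, Function.iterate_succ_apply',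
      smul_eq_mul]
    ring

/-- In characteristic `p`, the `p`-th iterate of a derivation is a derivation. -/
def Derivation.iterateChar_s11 {k S : Type*} [CommRing k] [CommRing S] [Algebra k S]
    (p : ℕ) [Fact p.Prime] [CharP S p] (D : Derivation k S S) : Derivation k S S :=
  Derivation.mk' ((D : S →ₗ[k] S) ^ p) fun a b => by
    have hp : p.Prime := Fact.out
    obtain ⟨q, rfl⟩ : ∃ q, p = q + 1 := ⟨p - 1, by have := hp.pos; omega⟩
    have hq : q ≠ 0 := by rintro rfl; exact Nat.not_prime_one hp
    simp only [Module.End.pow_apply, Derivation.coeFn_coe]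
    rw [Derivation.iterate_mul, Nat.sum_antidiagonal_eq_sum_range_succ_mk, sum_range_succ,
      sum_range_succ', sum_eq_zero]
    · simp; ring
    · intro i hi
      have hi' := mem_range.mp hi
      have : (((q + 1).choose (i + 1) : ℕ) : S) = 0 :=
        (CharP.cast_eq_zero_iff S (q + 1) _).mpr
          (hp.dvd_choose_self (by omega) (by omega))
      simp [this]

theorem Derivation.iterateChar_apply_s11 {k S : Type*} [CommRing k] [CommRing S] [Algebra k S]
    (p : ℕ) [Fact p.Prime] [CharP S p] (D : Derivation k S S) (z : S) :
    D.iterateChar_s11 p z = D^[p] z := by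
  simp [Derivation.iterateChar_s11, Module.End.pow_apply]

theorem Derivation.iterate_mul_of_eq_zero {k S : Type*} [CommRing k] [CommRing S] [Algebra k S]
    (D : Derivation k S S) {c : S} (hc : D c = 0) (n : ℕ) (z : S) :
    D^[n] (c * z) = c * D^[n] z := by
  induction n with
  | zero => rfl
  | succ n ih => simp [Function.iterate_succ_apply', ih, hc]

theorem Derivation.iterate_sub {k S : Type*} [CommRing k] [CommRing S] [Algebra k S]
    (D : Derivation k S S) (n : ℕ) (a b : S) : D^[n] (a - b) = D^[n] a - D^[n] b :=
  iterate_map_sub D n a b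

/-- The derivative in the parameter `X` of the iterates of the twisted operator
`z ↦ z′ + u X z`, applied to `1`. -/
theorem derivative_iterate_twist {S : Type*} [CommRing S] [Differential S] (u : S) (n : ℕ) :
    let E : Polynomial S → Polynomial S := fun z =>
      Differential.mapCoeffs z + Polynomial.C u * Polynomial.X * z
    Polynomial.derivative (E^[n] 1) =
      ∑ j ∈ range n, (n.choose (j + 1) : Polynomial S) *
        (Polynomial.C ((⇑(Differential.deriv (R := S)))^[j] u) * E^[n - 1 - j] 1) := by
  intro E
  have hder (z : Polynomial S) : Polynomial.derivative (E z) =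
      E (Polynomial.derivative z) + Polynomial.C u * z := by
    have h : Polynomial.derivative (Differential.mapCoeffs z) =
        Differential.mapCoeffs (Polynomial.derivative z) := by
      ext i
      simp only [Polynomial.coeff_derivative, Differential.coeff_mapCoeffs]
      rw [Derivation.leibniz]
      have : Differential.deriv ((i : S) + 1) = 0 := by
        rw [map_add, Derivation.map_natCast, Derivation.map_one_eq_zero, add_zero]
      rw [this]; simp [mul_comm]
    simp only [E, Polynomial.derivative_add, h, Polynomial.derivative_mul, Polynomial.derivative_C,
      Polynomial.derivative_X]
    ring
  have hE (m j : ℕ) (z : Polynomial S) :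
      E ((m : Polynomial S) * (Polynomial.C ((⇑(Differential.deriv (R := S)))^[j] u) * z)) =
      (m : Polynomial S) *
        (Polynomial.C ((⇑(Differential.deriv (R := S)))^[j + 1] u) * z) +
      (m : Polynomial S) * (Polynomial.C ((⇑(Differential.deriv (R := S)))^[j] u) * E z) := by
    simp only [E, Derivation.leibniz, Derivation.map_natCast, Differential.mapCoeffs_C,
      Function.iterate_succ_apply', smul_eq_mul]
    ring
  have hsum (m : ℕ) (s : ℕ → Polynomial S) :
      E (∑ j ∈ range m, s j) = ∑ j ∈ range m, E (s j) := by
    simp only [E, map_sum, mul_sum, sum_add_distrib]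
  induction n with
  | zero => simp
  | succ n ih =>
    rw [Function.iterate_succ_apply', hder, ih, hsum]
    simp only [hE]
    rw [sum_add_distrib]
    have hpascal : ∀ j ∈ range (n + 1), ((n + 1).choose (j + 1) : Polynomial S) *
        (Polynomial.C ((⇑(Differential.deriv (R := S)))^[j] u) * E^[n + 1 - 1 - j] 1) =
        (n.choose j : Polynomial S) *
        (Polynomial.C ((⇑(Differential.deriv (R := S)))^[j] u) * E^[n - j] 1) +
        (n.choose (j + 1) : Polynomial S) *
        (Polynomial.C ((⇑(Differential.deriv (R := S)))^[j] u) * E^[n - j] 1) := by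
      intro j _
      rw [Nat.choose_succ_succ]; simp only [Nat.succ_eq_add_one, Nat.add_sub_cancel]; push_cast; ring
    rw [sum_congr rfl hpascal, sum_add_distrib, sum_range_succ', sum_range_succ _ n]
    have h1 : ∀ j ∈ range n, (n.choose (j + 1) : Polynomial S) *
        (Polynomial.C ((⇑(Differential.deriv (R := S)))^[j + 1] u) * E^[n - 1 - j] 1) =
        (n.choose (j + 1) : Polynomial S) *
        (Polynomial.C ((⇑(Differential.deriv (R := S)))^[j + 1] u) * E^[n - (j + 1)] 1) := by
      intro j _
      rw [Nat.sub_sub, Nat.add_comm 1 j]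
    have h2 : ∀ j ∈ range n, (n.choose (j + 1) : Polynomial S) *
        (Polynomial.C ((⇑(Differential.deriv (R := S)))^[j] u) * E (E^[n - 1 - j] 1)) =
        (n.choose (j + 1) : Polynomial S) *
        (Polynomial.C ((⇑(Differential.deriv (R := S)))^[j] u) * E^[n - j] 1) := by
      intro j hj
      have := mem_range.mp hj
      rw [← Function.iterate_succ_apply' E, show (n - 1 - j).succ = n - j by omega]
    rw [sum_congr rfl h1, sum_congr rfl h2]
    simp
    ring

/-- Jacobson's formula for the `p`-th power of a derivation plus a multiplication operator. -/
theorem iterate_deriv_add_mul_one {S : Type*} [Field S] [Differential S] (p : ℕ) [Fact p.Prime]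
    [CharP S p] (u : S) :
    (fun z => Differential.deriv z + u * z)^[p] 1 =
      (⇑(Differential.deriv (R := S)))^[p - 1] u + u ^ p := by
  have hp : p.Prime := Fact.out
  set E : Polynomial S → Polynomial S := fun z =>
    Differential.mapCoeffs z + Polynomial.C u * Polynomial.X * z with hE
  have hder := derivative_iterate_twist u p
  simp only [← hE] at hder
  have hcoeff (z : Polynomial S) (i : ℕ) :
      (E z).coeff (i + 1) = Differential.deriv (z.coeff (i + 1)) + u * z.coeff i := by
    simp only [hE, Polynomial.coeff_add, Differential.coeff_mapCoeffs, mul_assoc,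
      Polynomial.coeff_C_mul, Polynomial.coeff_X_mul]
  have hcoeff0 (z : Polynomial S) : (E z).coeff 0 = Differential.deriv (z.coeff 0) := by
    simp [hE, mul_assoc]
  have hdeg (n i : ℕ) (hi : n < i) : (E^[n] 1).coeff i = 0 := by
    induction n generalizing i with
    | zero =>
      rw [Function.iterate_zero, id, Polynomial.coeff_one, if_neg (by omega)]
    | succ n ih =>
      obtain ⟨i, rfl⟩ : ∃ j, i = j + 1 := ⟨i - 1, by omega⟩
      rw [Function.iterate_succ_apply', hcoeff, ih _ (by omega), ih _ (by omega)]
      simp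
  have htop (n : ℕ) : (E^[n] 1).coeff n = u ^ n := by
    induction n with
    | zero => simp
    | succ n ih =>
      rw [Function.iterate_succ_apply', hcoeff, ih, hdeg n _ (by omega)]
      simp [pow_succ']
  have hbot (n : ℕ) : (E^[n + 1] 1).coeff 0 = 0 := by
    induction n with
    | zero => simp [hcoeff0]
    | succ n ih => rw [Function.iterate_succ_apply', hcoeff0, ih, map_zero]
  have heval (n : ℕ) : (fun z => Differential.deriv z + u * z)^[n] 1 =
      ∑ i ∈ range (n + 1), (E^[n] 1).coeff i := by
    induction n with
    | zero => simp
    | succ n ih =>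
      rw [Function.iterate_succ_apply', Function.iterate_succ_apply', ih,
        sum_range_succ' _ (n + 1)]
      simp only [hcoeff, hcoeff0, sum_add_distrib, ← mul_sum, map_sum]
      rw [sum_range_succ (fun i => Differential.deriv ((E^[n] 1).coeff (i + 1))),
        hdeg n (n + 1) (by omega), sum_range_succ' (fun i => Differential.deriv _)]
      simp
      ring
  obtain ⟨q, rfl⟩ : ∃ q, p = q + 2 := ⟨p - 2, by have := hp.two_le; omega⟩
  rw [sum_range_succ, sum_eq_zero, zero_add] at hder
  · have hc (i : ℕ) := congrArg (fun P => Polynomial.coeff P i) hder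
    simp only [Polynomial.coeff_derivative] at hc
    rw [heval, sum_range_succ, htop, sum_range_succ', sum_range_succ', hbot, sum_eq_zero]
    · have := hc 0
      simp at this
      simp [this]
    · intro i hi
      have hi' := mem_range.mp hi
      have h := hc (i + 1)
      have hne : ((i + 1 : ℕ) : S) + 1 ≠ 0 := by
        intro h0
        have : (((i + 2 : ℕ)) : S) = 0 := by push_cast at h0 ⊢; linear_combination h0
        rw [CharP.cast_eq_zero_iff S (q + 2)] at this
        have := Nat.le_of_dvd (by omega) this
        omega
      have : (E^[q + 2] 1).coeff (i + 1 + 1) * (((i + 1 : ℕ) : S) + 1) = 0 := by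
        rw [h]; simp [Polynomial.coeff_C_succ]
      exact (mul_eq_zero.mp this).resolve_right hne
  · intro j hj
    have hj' := mem_range.mp hj
    have : (((q + 2).choose (j + 1) : ℕ) : S) = 0 :=
      (CharP.cast_eq_zero_iff S (q + 2) _).mpr (hp.dvd_choose_self (by omega) (by omega))
    rw [← Polynomial.C_eq_natCast, this]
    simp

/-- Hochschild's identity for the logarithmic form `x⁻¹ dx`, cleared of denominators. -/
theorem Derivation.pow_mul_iterate {k S : Type*} [CommRing k] [Field S] [Algebra k S] (p : ℕ)
    [Fact p.Prime] [CharP S p] (D : Derivation k S S) {x : S} (hx : x ≠ 0) :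
    x ^ (p - 1) * D^[p] x = D^[p - 1] (x ^ (p - 1) * D x) + (D x) ^ p := by
  have hp : p.Prime := Fact.out
  let _ : Differential S := ⟨D.restrictScalars ℤ⟩
  have hD : ⇑(Differential.deriv (R := S)) = ⇑D := rfl
  have hJ := iterate_deriv_add_mul_one p (x⁻¹ * D x)
  rw [hD] at hJ
  have hconj (n : ℕ) : (fun z => D z + x⁻¹ * D x * z)^[n] 1 = x⁻¹ * D^[n] x := by
    induction n with
    | zero => simp [hx]
    | succ n ih =>
      rw [Function.iterate_succ_apply', Function.iterate_succ_apply', ih, Derivation.leibniz,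
        Derivation.leibniz_inv]
      simp only [smul_eq_mul]
      field_simp
      ring
  have hpow : D (x ^ p) = 0 := by
    rw [Derivation.leibniz_pow, ← Nat.cast_smul_eq_nsmul S, CharP.cast_eq_zero, zero_smul]
  have hxp : x ^ p = x ^ (p - 1) * x := by rw [← pow_succ, Nat.sub_add_cancel hp.pos]
  have h1 : x ^ (p - 1) * D x = x ^ p * (x⁻¹ * D x) := by rw [hxp]; field_simp
  rw [h1, Derivation.iterate_mul_of_eq_zero D hpow]
  rw [hconj, mul_pow, inv_pow] at hJ
  have h2 : x ^ (p - 1) * D^[p] x = x ^ p * (x⁻¹ * D^[p] x) := by rw [hxp]; field_simp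
  rw [h2, hJ]
  field_simp

/-- A primitive of `h`, up to a multiple of `x ^ (p - 1)`, by iterated integration by parts. -/
def partialPrimitive {k S : Type*} [CommRing k] [Field S] [Algebra k S]
    (d : Derivation k S S) (x : S) (n : ℕ) (h : S) : S :=
  ∑ i ∈ range n, (-1) ^ i * ((i + 1).factorial : S)⁻¹ * x ^ (i + 1) * d^[i] h

theorem Derivation.map_partialPrimitive {k S : Type*} [CommRing k] [Field S] [Algebra k S]
    (p : ℕ) [Fact p.Prime] [CharP S p] (d : Derivation k S S) {x : S} (hx : d x = 1) (h : S) :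
    d (partialPrimitive d x (p - 1) h) = h + x ^ (p - 1) * d^[p - 1] h := by
  have hp : p.Prime := Fact.out
  have hfac (n : ℕ) (hn : n < p) : (n.factorial : S) ≠ 0 := by
    rw [Ne, CharP.cast_eq_zero_iff S p, hp.dvd_factorial]; omega
  have hinv (m : ℕ) : d ((m : S)⁻¹) = 0 := by
    rw [Derivation.leibniz_inv, Derivation.map_natCast, smul_zero]
  have key (n : ℕ) (hn : n < p) : d (partialPrimitive d x n h) =
      h - (-1) ^ n * (n.factorial : S)⁻¹ * x ^ n * d^[n] h := by
    induction n with
    | zero => simp [partialPrimitive]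
    | succ n ih =>
      have hstep : partialPrimitive d x (n + 1) h = partialPrimitive d x n h +
          (-1) ^ n * ((n + 1).factorial : S)⁻¹ * x ^ (n + 1) * d^[n] h := by
        simp only [partialPrimitive, sum_range_succ]
      have hneg : d ((-1 : S) ^ n) = 0 := by
        rw [Derivation.leibniz_pow, Derivation.map_neg, Derivation.map_one_eq_zero]; simp
      have h1 := hfac n (by omega)
      have h2 := hfac (n + 1) hn
      rw [hstep, map_add, ih (by omega)]
      simp only [Derivation.leibniz, Derivation.leibniz_pow, hneg, hinv, hx, smul_eq_mul,
        nsmul_eq_mul, Function.iterate_succ_apply']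
      rw [Nat.factorial_succ] at h2 ⊢
      push_cast at h2 ⊢
      have h3 := (mul_ne_zero_iff.mp h2).1
      field_simp
      ring
  rw [key _ (Nat.sub_lt hp.pos one_pos)]
  have hw : ((p - 1).factorial : S) = -1 := by
    have h := congrArg (ZMod.castHom (dvd_refl p) S) (ZMod.wilsons_lemma p)
    rwa [_root_.map_natCast, _root_.map_neg, _root_.map_one] at h
  have hs : (-1 : S) ^ (p - 1) = 1 := by
    have := neg_one_pow_char S p
    rw [← Nat.sub_add_cancel hp.pos, pow_succ] at this
    linear_combination -this
  rw [hw, hs]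
  norm_num

theorem Function.Commute.iterate_eq_zero {S : Type*} [Zero S] {d e : S → S}
    (hde : Function.Commute d e) (hd : d 0 = 0) {z : S} (hz : e z = 0) (n : ℕ) :
    e (d^[n] z) = 0 := by
  rw [← (hde.iterate_left n) z, hz, Function.iterate_fixed hd]

/-- Katz's formula for the Cartier operator: for the closed form `G dx + H dy` and a derivation
`E`, the failure of `E ^ p` to pair like the `(p - 1)`-st iterate. -/
theorem katz_formula {k S : Type*} [CommRing k] [Field S] [Algebra k S] (p : ℕ) [Fact p.Prime]
    [CharP S p] (d e E : Derivation k S S) {x y : S} (hx0 : x ≠ 0) (hy0 : y ≠ 0)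
    (hdx : d x = 1) (hex : e x = 0) (hdy : d y = 0) (hey : e y = 1)
    (hgen : ∀ (D : Derivation k S S) (z : S), D z = D x * d z + D y * e z)
    {G H : S} (hGH : e G = d H) :
    G * E^[p] x + H * E^[p] y = E^[p - 1] (G * E x + H * E y)
      - d^[p - 1] G * (E x) ^ p - e^[p - 1] H * (E y) ^ p := by
  have hp : p.Prime := Fact.out
  have hsucc (D : Derivation k S S) (z : S) : D (D^[p - 1] z) = D^[p] z := by
    rw [← Function.iterate_succ_apply' D, Nat.succ_eq_add_one, Nat.sub_add_cancel hp.pos]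
  have hcomm : Function.Commute d e := by
    intro z
    have := hgen ⁅d, e⁆ z
    simp only [Derivation.commutator_apply, hdx, hex, hdy, hey, map_zero,
      Derivation.map_one_eq_zero] at this
    linear_combination this
  have hit (n : ℕ) (D : Derivation k S S) : D^[n] 0 = 0 := Function.iterate_fixed (map_zero D) n
  have hdp (z : S) : d^[p] z = 0 := by
    have h2 (w : S) (h : d w = 0 ∨ d w = 1) : d^[p] w = 0 := by
      obtain ⟨q, rfl⟩ : ∃ q, p = q + 2 := ⟨p - 2, by have := hp.two_le; omega⟩
      rw [Function.iterate_add_apply]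
      rcases h with h | h <;> simp [h, hit]
    have := hgen (d.iterateChar_s11 p) z
    simpa only [Derivation.iterateChar_apply_s11, h2 x (.inr hdx), h2 y (.inl hdy), zero_mul,
      add_zero] using this
  have hep (z : S) : e^[p] z = 0 := by
    have h2 (w : S) (h : e w = 0 ∨ e w = 1) : e^[p] w = 0 := by
      obtain ⟨q, rfl⟩ : ∃ q, p = q + 2 := ⟨p - 2, by have := hp.two_le; omega⟩
      rw [Function.iterate_add_apply]
      rcases h with h | h <;> simp [h, hit]
    have := hgen (e.iterateChar_s11 p) z
    simpa only [Derivation.iterateChar_apply_s11, h2 x (.inl hex), h2 y (.inr hey), zero_mul,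
      add_zero] using this
  set A := d^[p - 1] G with hA
  set B := e^[p - 1] H with hB
  have hdA : d A = 0 := by rw [hA, hsucc, hdp]
  have heB : e B = 0 := by rw [hB, hsucc, hep]
  have heA : e A = 0 := by
    rw [hA, ← (hcomm.iterate_left (p - 1)) G, hGH, ← Function.iterate_succ_apply d,
      Nat.succ_eq_add_one, Nat.sub_add_cancel hp.pos, hdp]
  have hdB : d B = 0 := by
    rw [hB, (hcomm.iterate_right (p - 1)) H, ← hGH, ← Function.iterate_succ_apply e,
      Nat.succ_eq_add_one, Nat.sub_add_cancel hp.pos, hep]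
  have hEA : E A = 0 := by rw [hgen E A, hdA, heA]; ring
  have hEB : E B = 0 := by rw [hgen E B, hdB, heB]; ring
  set F₁ := partialPrimitive d x (p - 1) G with hF₁
  have hdF₁ : d F₁ = G + x ^ (p - 1) * A := d.map_partialPrimitive p hdx G
  set H₁ := H - e F₁ with hH₁
  have hdH₁ : d H₁ = 0 := by
    rw [hH₁, map_sub, hcomm F₁, hdF₁, ← hGH]
    simp [Derivation.leibniz_pow, heA, hex]
  set F₂ := partialPrimitive e y (p - 1) H₁ with hF₂
  have heF₂ : e F₂ = H₁ + y ^ (p - 1) * B := by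
    rw [hF₂, e.map_partialPrimitive p hey H₁, hH₁, Derivation.iterate_sub,
      ← Function.iterate_succ_apply e, Nat.succ_eq_add_one, Nat.sub_add_cancel hp.pos, hep,
      sub_zero]
  have hdF₂ : d F₂ = 0 := by
    rw [hF₂, partialPrimitive, map_sum]
    refine sum_eq_zero fun i _ => ?_
    have h0 : d (e^[i] H₁) = 0 := hcomm.symm.iterate_eq_zero (map_zero e) hdH₁ i
    have hneg : d ((-1 : S) ^ i) = 0 := by
      rw [Derivation.leibniz_pow, Derivation.map_neg, Derivation.map_one_eq_zero]; simp
    simp only [Derivation.leibniz, Derivation.leibniz_pow, hneg, h0, hdy, Derivation.leibniz_inv,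
      Derivation.map_natCast, smul_zero, add_zero]
  have hG : G = d (F₁ + F₂) - x ^ (p - 1) * A := by
    rw [map_add, hdF₁, hdF₂]; ring
  have hH : H = e (F₁ + F₂) - y ^ (p - 1) * B := by
    rw [map_add, heF₂, hH₁]; ring
  have hEF := hgen E (F₁ + F₂)
  have hEpF := hgen (E.iterateChar_s11 p) (F₁ + F₂)
  simp only [Derivation.iterateChar_apply_s11] at hEpF
  have hω : G * E x + H * E y = E (F₁ + F₂) - A * (x ^ (p - 1) * E x)
      - B * (y ^ (p - 1) * E y) := by
    rw [hEF]
    linear_combination E x * hG + E y * hH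
  rw [hω, Derivation.iterate_sub, Derivation.iterate_sub, E.iterate_mul_of_eq_zero hEA,
    E.iterate_mul_of_eq_zero hEB, ← Function.iterate_succ_apply E, Nat.succ_eq_add_one,
    Nat.sub_add_cancel hp.pos, hEpF]
  have hx := E.pow_mul_iterate p hx0
  have hy := E.pow_mul_iterate p hy0
  linear_combination E^[p] x * hG + E^[p] y * hH - A * hx - B * hy

theorem derivation_ratFld2_eq_zero {k : Type} [Field k]
    (D : Derivation k (RatFld2 k) (RatFld2 k)) (hx : D (xK k) = 0) (hy : D (yK k) = 0)
    (z : RatFld2 k) : D z = 0 := by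
  have h0 : D.compAlgebraMap (MvPolynomial (Fin 2) k) = 0 :=
    MvPolynomial.derivation_ext fun i => by fin_cases i <;> simpa
  have hR (r : MvPolynomial (Fin 2) k) : D (algebraMap _ (RatFld2 k) r) = 0 := by
    simpa using Derivation.congr_fun h0 r
  obtain ⟨a, b, _, rfl⟩ := IsFractionRing.div_surjective (A := MvPolynomial (Fin 2) k) z
  rw [Derivation.leibniz_div, hR, hR]
  simp

theorem derivation_ratFld2_eq {k : Type} [Field k]
    {Dx Dy : Derivation k (RatFld2 k) (RatFld2 k)}
    (hDxx : Dx (xK k) = 1) (hDxy : Dx (yK k) = 0)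
    (hDyx : Dy (xK k) = 0) (hDyy : Dy (yK k) = 1)
    (D : Derivation k (RatFld2 k) (RatFld2 k)) (z : RatFld2 k) :
    D z = D (xK k) * Dx z + D (yK k) * Dy z := by
  have h := derivation_ratFld2_eq_zero (D - (D (xK k) • Dx + D (yK k) • Dy))
    (by simp [hDxx, hDyx]) (by simp [hDxy, hDyy]) z
  simpa [sub_eq_zero] using h

theorem algebraMap_eq_of_derivation {k : Type} [Field k]
    {D : Derivation k (RatFld2 k) (RatFld2 k)}
    {d : Derivation k (MvPolynomial (Fin 2) k) (MvPolynomial (Fin 2) k)}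
    (h : ∀ i, D (algebraMap (MvPolynomial (Fin 2) k) (RatFld2 k) (X i)) =
      algebraMap _ (RatFld2 k) (d (X i)))
    (r : MvPolynomial (Fin 2) k) :
    D (algebraMap _ (RatFld2 k) r) = algebraMap _ (RatFld2 k) (d r) := by
  have h0 : D.compAlgebraMap (MvPolynomial (Fin 2) k) =
      (Algebra.linearMap (MvPolynomial (Fin 2) k) (RatFld2 k)).compDer d :=
    MvPolynomial.derivation_ext fun i => by simpa using h i
  simpa using Derivation.congr_fun h0 r

theorem totalDegree_pderiv_le {σ k : Type*} [CommSemiring k] (i : σ) (f : MvPolynomial σ k) :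
    (pderiv i f).totalDegree ≤ f.totalDegree := by
  refine Finset.sup_le fun m hm => ?_
  rw [mem_support_iff, coeff_pderiv] at hm
  have hm' : m + Finsupp.single i 1 ∈ f.support := by
    rw [mem_support_iff]; exact left_ne_zero_of_mul hm
  refine le_trans ?_ (le_totalDegree hm')
  rw [Finsupp.sum_add_index' (by simp) (by simp)]
  omega

theorem iterate_pderiv_eq_zero_of_pow_dvd {σ k : Type*} [Field k] (i : σ) (n p : ℕ) (hn : n ≠ 0)
    (hp : 2 ≤ p) {f : MvPolynomial σ k} (hf : f ≠ 0)
    (hdvd : f ^ p ∣ (⇑(pderiv (R := k) i))^[n] f) : (⇑(pderiv (R := k) i))^[n] f = 0 := by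
  by_contra hne
  obtain ⟨q, hq⟩ := hdvd
  have hq0 : q ≠ 0 := by rintro rfl; simp [hq] at hne
  have hle (m : ℕ) : ((⇑(pderiv (R := k) i))^[m] f).totalDegree ≤ f.totalDegree := by
    induction m with
    | zero => rfl
    | succ m ih =>
      rw [Function.iterate_succ_apply']
      exact (totalDegree_pderiv_le i _).trans ih
  have h := hle n
  rw [hq, totalDegree_mul_of_isDomain (pow_ne_zero p hf) hq0] at h
  have hpow : (f ^ p).totalDegree = p * f.totalDegree := by
    clear * - hf
    induction p with
    | zero => simp
    | succ p ih =>
      rw [pow_succ, totalDegree_mul_of_isDomain (pow_ne_zero p hf) hf, ih]; ring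
  rw [hpow] at h
  have h0 : f.totalDegree = 0 := by nlinarith
  obtain ⟨m, rfl⟩ := Nat.exists_eq_succ_of_ne_zero hn
  apply hne
  rw [totalDegree_eq_zero_iff_eq_C.mp h0, Function.iterate_succ_apply, pderiv_C]
  exact Function.iterate_fixed (map_zero _) m

/-- Example (1) of the paper: if `f, g ∈ k[x,y]` are nonzero coprime polynomials with
`∂_x(f) + ∂_y(g) = 0`, then the derivation `∂ = f·∂_x + g·∂_y` of `K = k(x,y)` is
`p`-closed if and only if `∂_y^{p−1}(f) = 0` and `∂_x^{p−1}(g) = 0`. -/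
theorem p_closed_iff_cf_cg_zero_of_coprime
    (p : ℕ) (hp : p.Prime) (k : Type) [Field k] [CharP k p]
    (Dx Dy : Derivation k (RatFld2 k) (RatFld2 k))
    (hDxx : Dx (xK k) = 1) (hDxy : Dx (yK k) = 0)
    (hDyx : Dy (xK k) = 0) (hDyy : Dy (yK k) = 1)
    (f g : MvPolynomial (Fin 2) k) (hf : f ≠ 0) (hg : g ≠ 0)
    (hcop : IsRelPrime f g)
    (hdiv : Px k f + Py k g = 0) :
    (∃ a : RatFld2 k, ∀ z,
        (⇑((algebraMap (MvPolynomial (Fin 2) k) (RatFld2 k) f) • Dx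
            + (algebraMap (MvPolynomial (Fin 2) k) (RatFld2 k) g) • Dy))^[p] z
          = a * ((algebraMap (MvPolynomial (Fin 2) k) (RatFld2 k) f) • Dx
            + (algebraMap (MvPolynomial (Fin 2) k) (RatFld2 k) g) • Dy) z)
      ↔ ((⇑(Py k))^[p - 1] f = 0 ∧ (⇑(Px k))^[p - 1] g = 0) := by
  have : Fact p.Prime := ⟨hp⟩
  have : CharP (RatFld2 k) p := charP_of_injective_algebraMap (algebraMap k (RatFld2 k)).injective p
  have hinj : Function.Injective (algebraMap (MvPolynomial (Fin 2) k) (RatFld2 k)) :=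
    IsFractionRing.injective _ _
  set φ := algebraMap (MvPolynomial (Fin 2) k) (RatFld2 k) with hφ
  have hPx (r : MvPolynomial (Fin 2) k) : Dx (φ r) = φ (Px k r) :=
    algebraMap_eq_of_derivation (fun i => by fin_cases i <;> simp [hDxx, hDxy]) r
  have hPy (r : MvPolynomial (Fin 2) k) : Dy (φ r) = φ (Py k r) :=
    algebraMap_eq_of_derivation (fun i => by fin_cases i <;> simp [hDyx, hDyy]) r
  have hPxn (n : ℕ) (r : MvPolynomial (Fin 2) k) : Dx^[n] (φ r) = φ ((⇑(Px k))^[n] r) :=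
    (Function.Semiconj.iterate_right (f := φ) (fun z => (hPx z).symm) n r).symm
  have hPyn (n : ℕ) (r : MvPolynomial (Fin 2) k) : Dy^[n] (φ r) = φ ((⇑(Py k))^[n] r) :=
    (Function.Semiconj.iterate_right (f := φ) (fun z => (hPy z).symm) n r).symm
  set E := φ f • Dx + φ g • Dy with hE
  have hEx : E (xK k) = φ f := by simp [hE, hDxx, hDyx]
  have hEy : E (yK k) = φ g := by simp [hE, hDxy, hDyy]
  have hx0 : xK k ≠ 0 := (map_ne_zero_iff φ hinj).mpr (X_ne_zero 0)
  have hy0 : yK k ≠ 0 := (map_ne_zero_iff φ hinj).mpr (X_ne_zero 1)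
  have hφf : φ f ≠ 0 := (map_ne_zero_iff φ hinj).mpr hf
  have hgen := derivation_ratFld2_eq hDxx hDxy hDyx hDyy
  have hclosed : Dy (φ g) = Dx (-φ f) := by
    have := congrArg φ hdiv
    rw [map_add, map_zero] at this
    rw [map_neg, hPx, hPy]
    linear_combination this
  have hkatz := katz_formula p Dx Dy E hx0 hy0 hDxx hDyx hDxy hDyy hgen hclosed
  have hzero : φ g * E (xK k) + -φ f * E (yK k) = 0 := by rw [hEx, hEy]; ring
  rw [hzero, Function.iterate_fixed (map_zero E), hEx, hEy, ← map_neg φ, hPxn, hPyn,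
    iterate_map_neg] at hkatz
  simp only [map_neg] at hkatz
  constructor
  · rintro ⟨a, ha⟩
    rw [ha, ha, hEx, hEy] at hkatz
    have heq : f ^ p * (⇑(Px k))^[p - 1] g = g ^ p * (⇑(Py k))^[p - 1] f := by
      apply hinj
      simp only [map_mul, map_pow]
      linear_combination hkatz
    have hcop' : IsRelPrime (f ^ p) (g ^ p) := hcop.pow
    have hp1 : p - 1 ≠ 0 := by have := hp.two_le; omega
    exact ⟨iterate_pderiv_eq_zero_of_pow_dvd 1 (p - 1) p hp1 hp.two_le hf
        (hcop'.dvd_of_dvd_mul_left ⟨_, heq.symm⟩),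
      iterate_pderiv_eq_zero_of_pow_dvd 0 (p - 1) p hp1 hp.two_le hg
        (hcop'.symm.dvd_of_dvd_mul_left ⟨_, heq⟩)⟩
  · rintro ⟨hA, hB⟩
    rw [hA, hB] at hkatz
    simp only [map_zero, neg_zero, zero_mul, sub_zero] at hkatz
    refine ⟨E^[p] (xK k) / φ f, fun z => ?_⟩
    have h1 := hgen (E.iterateChar_s11 p) z
    have h2 := hgen E z
    simp only [Derivation.iterateChar_apply_s11] at h1
    rw [h1, h2, hEx, hEy]
    field_simp
    linear_combination -Dy z * hkatz
end
end

section
/- Let k be a field of characteristic p > 0 and K = k(x,y). Set f = g = (x − y)^{p−1} and ∂ = f·∂_x + g·∂_y. Then ∂ is p-closed (there exists a ∈ K with ∂^p = a·∂), while −∂_y^{p−1}(f) = 1 and −∂_x^{p−1}(g) = 1. -/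
open MvPolynomial

noncomputable section

namespace Derivation

variable {k A : Type*} [CommRing k] [CommRing A] [Algebra k A]

theorem iterate_mul_s12 (D : Derivation k A A) (n : ℕ) (a b : A) :
    (⇑D)^[n] (a * b) =
      ∑ ij ∈ Finset.HasAntidiagonal.antidiagonal n, n.choose ij.1 • ((⇑D)^[ij.1] a * (⇑D)^[ij.2] b) := by
  induction n with
  | zero => simp
  | succ n ih =>
    rw [Finset.sum_antidiagonal_choose_succ_nsmul (M := A)
      (fun i j => (⇑D)^[i] a * (⇑D)^[j] b) n]
    simp only [Function.iterate_succ_apply', ih, map_sum, map_nsmul, leibniz, smul_eq_mul,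
      smul_add, Finset.sum_add_distrib]
    congr 1
    refine Finset.sum_congr rfl fun ij hij => ?_
    rw [n.choose_symm_of_eq_add (Finset.HasAntidiagonal.mem_antidiagonal.1 hij).symm, mul_comm]

theorem iterate_prime_mul (p : ℕ) (hp : p.Prime) [CharP A p] (D : Derivation k A A) (a b : A) :
    (⇑D)^[p] (a * b) = a * (⇑D)^[p] b + b * (⇑D)^[p] a := by
  rw [iterate_mul_s12, Finset.Nat.sum_antidiagonal_eq_sum_range_succ
    (fun i j => p.choose i • ((⇑D)^[i] a * (⇑D)^[j] b)), Finset.sum_range_succ,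
    ← Finset.sum_erase_add _ _ (Finset.mem_range.2 hp.pos), Finset.sum_eq_zero]
  · simp [mul_comm]
  · intro i hi
    rw [Finset.mem_erase, Finset.mem_range] at hi
    rw [nsmul_eq_mul, (CharP.cast_eq_zero_iff A p _).2 (hp.dvd_choose_self hi.1 hi.2), zero_mul]

/-- In prime characteristic `p`, the `p`-fold iterate of a derivation is a derivation. -/
def iteratePrime (p : ℕ) (hp : p.Prime) [CharP A p] (D : Derivation k A A) : Derivation k A A :=
  mk' ((D : A →ₗ[k] A) ^ p) fun a b => by
    simpa [Module.End.pow_apply] using iterate_prime_mul p hp D a b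

theorem iteratePrime_apply (p : ℕ) (hp : p.Prime) [CharP A p] (D : Derivation k A A) (a : A) :
    iteratePrime p hp D a = (⇑D)^[p] a := by
  simp [iteratePrime, Module.End.pow_apply]

theorem iterate_smul_apply (D : Derivation k A A) {c : A} (hc : D c = 0) (n : ℕ) (a : A) :
    (⇑(c • D))^[n] a = c ^ n * (⇑D)^[n] a := by
  induction n with
  | zero => simp
  | succ n ih =>
    rw [Function.iterate_succ_apply', Function.iterate_succ_apply', ih, smul_apply, leibniz,
      leibniz_pow, hc]
    simp only [smul_eq_mul, smul_zero, mul_zero, add_zero]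
    ring

theorem iterate_pow_apply (D : Derivation k A A) {v s : A} (hv : D v = s) (hs : D s = 0)
    (m n : ℕ) : (⇑D)^[n] (v ^ m) = m.descFactorial n * s ^ n * v ^ (m - n) := by
  induction n with
  | zero => simp
  | succ n ih =>
    simp only [Function.iterate_succ_apply', ih, leibniz, leibniz_pow, hs, hv, map_natCast,
      smul_eq_mul, smul_zero, mul_zero, add_zero, nsmul_eq_mul, Nat.descFactorial_succ,
      Nat.cast_mul, Nat.sub_sub]
    ring

theorem iterate_pow_prime_sub_one (p : ℕ) (hp : p.Prime) [CharP A p] (D : Derivation k A A)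
    {v s : A} (hv : D v = s) (hs : D s = 0) (h : s ^ (p - 1) = 1) :
    (⇑D)^[p - 1] (v ^ (p - 1)) = -1 := by
  have : Fact p.Prime := ⟨hp⟩
  have wilson := congrArg (ZMod.castHom (dvd_refl p) A) (ZMod.wilsons_lemma p)
  rw [_root_.map_natCast, _root_.map_neg, map_one] at wilson
  rw [iterate_pow_apply D hv hs, Nat.descFactorial_self, wilson, h]
  simp

/-- A derivation of a fraction field vanishing on the ring vanishes. -/
theorem eq_zero_of_algebraMap {R k K : Type*} [CommRing R] [Field K] [CommRing k] [Algebra k K]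
    [Algebra R K] [IsFractionRing R K] (D : Derivation k K K)
    (h : ∀ r : R, D (algebraMap R K r) = 0) : D = 0 := by
  ext z
  obtain ⟨⟨a, b⟩, hz⟩ := IsLocalization.surj (nonZeroDivisors R) z
  have hD := congrArg D hz
  rw [leibniz, h, h, smul_zero, zero_add, smul_eq_mul] at hD
  exact (mul_eq_zero.1 hD).resolve_left (IsLocalization.map_units K b).ne_zero

end Derivation

theorem RatFld2.derivation_eq_zero {k : Type} [Field k]
    (D : Derivation k (RatFld2 k) (RatFld2 k)) (hx : D (xK k) = 0) (hy : D (yK k) = 0) :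
    D = 0 := by
  refine D.eq_zero_of_algebraMap (R := MvPolynomial (Fin 2) k) fun r => ?_
  have h : D.compAlgebraMap (MvPolynomial (Fin 2) k) = 0 :=
    MvPolynomial.derivation_ext fun i => by fin_cases i <;> assumption
  exact DFunLike.congr_fun h r

/-- Example (1), counterexample part: for `f = g = (x − y)^{p−1}` in `K = k(x,y)`, the
derivation `∂ = f·∂_x + g·∂_y` is `p`-closed, while `−∂_y^{p−1}(f) = 1` and
`−∂_x^{p−1}(g) = 1`. -/
theorem p_closed_counterexample_nonzero_cf_cg
    (p : ℕ) (hp : p.Prime) (k : Type) [Field k] [CharP k p]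
    (Dx Dy : Derivation k (RatFld2 k) (RatFld2 k))
    (hDxx : Dx (xK k) = 1) (hDxy : Dx (yK k) = 0)
    (hDyx : Dy (xK k) = 0) (hDyy : Dy (yK k) = 1) :
    (∃ a : RatFld2 k, ∀ z,
        (⇑(((xK k - yK k) ^ (p - 1)) • Dx + ((xK k - yK k) ^ (p - 1)) • Dy))^[p] z
          = a * (((xK k - yK k) ^ (p - 1)) • Dx + ((xK k - yK k) ^ (p - 1)) • Dy) z)
      ∧ -(⇑Dy)^[p - 1] ((xK k - yK k) ^ (p - 1)) = 1
      ∧ -(⇑Dx)^[p - 1] ((xK k - yK k) ^ (p - 1)) = 1 := by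
  have : CharP (RatFld2 k) p :=
    charP_of_injective_algebraMap (algebraMap k (RatFld2 k)).injective p
  refine ⟨⟨0, fun z => ?_⟩, ?_, ?_⟩
  · have hD : ∀ t, (Dx + Dy) t = 1 → (Dx + Dy).iteratePrime p hp t = 0 := fun t ht => by
      obtain ⟨n, rfl⟩ := Nat.exists_eq_add_of_le' hp.two_le
      rw [Derivation.iteratePrime_apply, Function.iterate_add_apply, Function.iterate_succ_apply,
        ht, Function.iterate_one, Derivation.map_one_eq_zero]
      exact iterate_map_zero _ _
    have hE : (Dx + Dy).iteratePrime p hp = 0 :=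
      RatFld2.derivation_eq_zero _ (hD _ (by simp [hDxx, hDyx])) (hD _ (by simp [hDxy, hDyy]))
    rw [← smul_add, Derivation.iterate_smul_apply, ← Derivation.iteratePrime_apply p hp, hE]
    · simp
    · simp [Derivation.leibniz_pow, hDxx, hDxy, hDyx, hDyy]
  · rw [Dy.iterate_pow_prime_sub_one p hp (s := -1) (by simp [hDyx, hDyy]) (by simp), neg_neg]
    have : Fact p.Prime := ⟨hp⟩
    have h := neg_one_pow_char (RatFld2 k) p
    rw [← Nat.sub_add_cancel hp.one_le, pow_succ] at h
    simpa using h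
  · rw [Dx.iterate_pow_prime_sub_one p hp (s := 1) (by simp [hDxx, hDxy]) (by simp)
      (one_pow _), neg_neg]
end
end
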